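/- Fading is never good in low dimensions under spherically-invariant noise: let n ∈ {1, 2}, let μ be a Borel probability measure on (0, ∞), and let f be the SIRP noise density f(x) = ∫ (2πσ²)^{−n/2} exp(−‖x‖²/(2σ²)) dμ(σ). Let P_e(γ) = 1 − Σ_{i=1}^{M} q_i ∫_{√γ • Ω_i} f(x) dx be the symbol error rate of a decoder with center-convex decision regions at SNR γ > 0. Then for every Borel probability measure ν on (0, ∞) with ∫ g dν(g) = 1 (normalized fading power gain) and every average SNR γ₀ > 0, the average error rate satisfies ∫ P_e(g·γ₀) dν(g) ≥ P_e(γ₀). -/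

import Mathlib

open MeasureTheory Real Set Pointwise
open scoped ENNReal

/-- Integration in polar coordinates for nonnegative functions. -/
theorem lintegral_eq_lintegral_toSphere {E : Type*} [NormedAddCommGroup E] [NormedSpace ℝ E]
    [MeasurableSpace E] [BorelSpace E] [FiniteDimensional ℝ E] [Nontrivial E]
    (μ : Measure E) [μ.IsAddHaarMeasure] {F : E → ℝ≥0∞} (hF : Measurable F) :
    ∫⁻ x, F x ∂μ = ∫⁻ u, (∫⁻ r in Ioi (0 : ℝ),
      ENNReal.ofReal (r ^ (Module.finrank ℝ E - 1)) * F (r • (u : E))) ∂μ.toSphere := by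
  have hm : Measurable fun p : Metric.sphere (0 : E) 1 × Ioi (0 : ℝ) ↦
      F ((p.2 : ℝ) • (p.1 : E)) := by fun_prop
  have hpolar := μ.measurePreserving_homeomorphUnitSphereProd.lintegral_comp hm
  rw [lintegral_prod _ hm.aemeasurable] at hpolar
  calc ∫⁻ x, F x ∂μ = ∫⁻ x in ({0}ᶜ : Set E), F x ∂μ := by rw [restrict_compl_singleton]
    _ = ∫⁻ x : ({0}ᶜ : Set E), F x ∂(μ.comap (↑)) :=
      (lintegral_subtype_comap (measurableSet_singleton _).compl F).symm
    _ = _ := by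
      rw [← lintegral_congr fun x ↦ ?_, hpolar]
      · refine lintegral_congr fun u ↦ ?_
        have hu : Measurable fun r : Ioi (0 : ℝ) ↦ F ((r : ℝ) • (u : E)) := by fun_prop
        rw [Measure.volumeIoiPow, lintegral_withDensity_eq_lintegral_mul _ (by fun_prop) hu]
        exact lintegral_subtype_comap measurableSet_Ioi
          fun r : ℝ ↦ ENNReal.ofReal (r ^ (Module.finrank ℝ E - 1)) * F (r • (u : E))
      · have hx : ‖(x : E)‖ ≠ 0 := norm_ne_zero_iff.2 x.2
        simp [smul_smul, mul_inv_cancel₀ hx]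

/-- A form of the bathtub principle: if `w` takes larger values on `S` than off `S`, then replacing
`S` by `T` changes the integral of `w` by at most the infimum of `w` on `S` times the change of
measure. -/
theorem setLIntegral_add_iInf_mul_le {α : Type*} [MeasurableSpace α] (m : Measure α)
    {w : α → ℝ≥0∞} {S T : Set α} (hS : MeasurableSet S) (hT : MeasurableSet T)
    (h : ∀ x ∈ S, ∀ y ∈ T \ S, w y ≤ w x) :
    (∫⁻ x in T, w x ∂m) + (⨅ x ∈ S, w x) * m S ≤ (∫⁻ x in S, w x ∂m) + (⨅ x ∈ S, w x) * m T := by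
  set c := ⨅ x ∈ S, w x
  have hTS : ∫⁻ x in T \ S, w x ∂m ≤ c * m (T \ S) := by
    rw [← setLIntegral_const]
    exact setLIntegral_mono' (hT.diff hS) fun y hy ↦ le_iInf₂ fun x hx ↦ h x hx y hy
  have hST : c * m (S \ T) ≤ ∫⁻ x in S \ T, w x ∂m := by
    rw [← setLIntegral_const]
    exact setLIntegral_mono' (hS.diff hT) fun x hx ↦ iInf₂_le x hx.1
  rw [← lintegral_inter_add_sdiff w T hS, ← lintegral_inter_add_sdiff w S hT,
    ← measure_inter_add_sdiff S hT, ← measure_inter_add_sdiff T hS, inter_comm T S, mul_add, mul_add]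
  calc _ = ((∫⁻ x in S ∩ T, w x ∂m) + c * m (S ∩ T)) +
        ((∫⁻ x in T \ S, w x ∂m) + c * m (S \ T)) := by ring
    _ ≤ ((∫⁻ x in S ∩ T, w x ∂m) + c * m (S ∩ T)) +
        (c * m (T \ S) + ∫⁻ x in S \ T, w x ∂m) := by gcongr
    _ = _ := by ring

/-- Quadratic scaling of the measure `r dr` on the positive half-line. -/
theorem lintegral_Ioi_indicator_inv_mul {A : Set ℝ} (hA : MeasurableSet A) {c : ℝ} (hc : 0 < c) :
    ∫⁻ r in Ioi (0 : ℝ) ∩ (fun r ↦ c⁻¹ * r) ⁻¹' A, ENNReal.ofReal r =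
      ENNReal.ofReal (c ^ 2) * ∫⁻ r in Ioi (0 : ℝ) ∩ A, ENNReal.ofReal r := by
  have hB : MeasurableSet (Ioi (0 : ℝ) ∩ A) := measurableSet_Ioi.inter hA
  have hpre : Ioi (0 : ℝ) ∩ (fun r ↦ c⁻¹ * r) ⁻¹' A =
      (fun r ↦ c⁻¹ * r) ⁻¹' (Ioi (0 : ℝ) ∩ A) := by
    ext r
    simp [hc]
  have hmeas : Measurable fun r : ℝ ↦ c⁻¹ * r := by fun_prop
  have hG : Measurable ((Ioi (0 : ℝ) ∩ A).indicator ENNReal.ofReal) :=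
    ENNReal.measurable_ofReal.indicator hB
  have hscale : ∫⁻ r, (Ioi (0 : ℝ) ∩ A).indicator ENNReal.ofReal (c⁻¹ * r) =
      ENNReal.ofReal c * ∫⁻ r in Ioi (0 : ℝ) ∩ A, ENNReal.ofReal r := by
    rw [← lintegral_map hG hmeas, Real.map_volume_mul_left (inv_ne_zero hc.ne'),
      lintegral_smul_measure, lintegral_indicator hB, inv_inv, abs_of_pos hc, smul_eq_mul]
  rw [hpre, ← lintegral_indicator (hmeas hB), pow_two, ENNReal.ofReal_mul hc.le, mul_assoc,
    ← hscale, ← lintegral_const_mul _ (by fun_prop : Measurable fun r : ℝ ↦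
      (Ioi (0 : ℝ) ∩ A).indicator ENNReal.ofReal (c⁻¹ * r))]
  refine lintegral_congr fun r ↦ ?_
  by_cases hr : c⁻¹ * r ∈ Ioi (0 : ℝ) ∩ A
  · have hr' : r ∈ (fun r ↦ c⁻¹ * r) ⁻¹' (Ioi (0 : ℝ) ∩ A) := hr
    rw [indicator_of_mem hr, indicator_of_mem hr', ← ENNReal.ofReal_mul hc.le,
      mul_inv_cancel_left₀ hc.ne']
  · have hr' : r ∉ (fun r ↦ c⁻¹ * r) ⁻¹' (Ioi (0 : ℝ) ∩ A) := hr
    rw [indicator_of_notMem hr, indicator_of_notMem hr', mul_zero]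

theorem StarConvex.smul_set_subset_smul_set {E : Type*} [AddCommGroup E] [Module ℝ E] {S : Set E}
    (hS : StarConvex ℝ 0 S) {c d : ℝ} (hc : 0 ≤ c) (hcd : c ≤ d) : c • S ⊆ d • S := by
  rintro _ ⟨x, hx, rfl⟩
  rcases (hc.trans hcd).eq_or_lt with rfl | hd
  · exact ⟨x, hx, by simp [le_antisymm hcd hc]⟩
  · refine ⟨(c / d) • x, hS.smul_mem hx (by positivity) ((div_le_one hd).2 hcd), ?_⟩
    simp [smul_smul, mul_div_cancel₀ c hd.ne']

/-- The contribution of one ray to the integral of a radially decreasing function over a star-shaped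
set has, as a function of the squared scaling factor, a supporting line. -/
theorem setLIntegral_ray_le {A : Set ℝ} (hA : MeasurableSet A)
    (hAstar : ∀ r ∈ A, 0 < r → ∀ s, 0 < s → s ≤ r → s ∈ A)
    {w : ℝ → ℝ≥0∞} (hw : Measurable w) (hwanti : AntitoneOn w (Ioi 0)) :
    ∃ l ≤ ∫⁻ r in Ioi (0 : ℝ) ∩ A, ENNReal.ofReal r * w r, ∀ g : ℝ, 0 < g →
      (∫⁻ r in Ioi (0 : ℝ) ∩ (fun r ↦ (√g)⁻¹ * r) ⁻¹' A, ENNReal.ofReal r * w r) + l ≤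
        (∫⁻ r in Ioi (0 : ℝ) ∩ A, ENNReal.ofReal r * w r) + ENNReal.ofReal g * l := by
  set m : Measure ℝ := volume.withDensity ENNReal.ofReal with hm
  have hmS (S : Set ℝ) (hS : MeasurableSet S) :
      ∫⁻ r in S, ENNReal.ofReal r * w r = ∫⁻ r in S, w r ∂m := by
    rw [hm, setLIntegral_withDensity_eq_setLIntegral_mul _ ENNReal.measurable_ofReal hw hS]
    rfl
  have hS : MeasurableSet (Ioi (0 : ℝ) ∩ A) := measurableSet_Ioi.inter hA
  refine ⟨(⨅ r ∈ Ioi (0 : ℝ) ∩ A, w r) * m (Ioi (0 : ℝ) ∩ A), ?_, fun g hg ↦ ?_⟩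
  · rw [hmS _ hS, ← setLIntegral_const]
    exact setLIntegral_mono' hS fun x hx ↦ iInf₂_le x hx
  · have hT : MeasurableSet (Ioi (0 : ℝ) ∩ (fun r ↦ (√g)⁻¹ * r) ⁻¹' A) :=
      measurableSet_Ioi.inter ((measurable_const_mul _) hA)
    have hmT : m (Ioi (0 : ℝ) ∩ (fun r ↦ (√g)⁻¹ * r) ⁻¹' A) =
        ENNReal.ofReal g * m (Ioi (0 : ℝ) ∩ A) := by
      rw [hm, withDensity_apply _ hT, withDensity_apply _ hS,
        lintegral_Ioi_indicator_inv_mul hA (Real.sqrt_pos.2 hg), Real.sq_sqrt hg.le]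
    rw [hmS _ hS, hmS _ hT, mul_left_comm, ← hmT]
    refine setLIntegral_add_iInf_mul_le m hS hT fun x hx y hy ↦ ?_
    refine hwanti hx.1 hy.1.1 (le_of_not_gt fun hlt ↦ hy.2 ⟨hy.1.1, ?_⟩)
    exact hAstar x hx.2 hx.1 y hy.1.1 hlt.le

/-- In dimension at most two, the integral of a radially decreasing function over a dilated
star-shaped set has, as a function of the squared scaling factor, a supporting line. -/
theorem StarConvex.setLIntegral_sqrt_smul_le {E : Type*} [NormedAddCommGroup E] [NormedSpace ℝ E]
    [MeasurableSpace E] [BorelSpace E] [FiniteDimensional ℝ E] [Nontrivial E]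
    (μ : Measure E) [μ.IsAddHaarMeasure] (hdim : Module.finrank ℝ E ≤ 2) {S : Set E}
    (hS : MeasurableSet S) (hstar : StarConvex ℝ 0 S) {h : ℝ → ℝ≥0∞} (hh : Measurable h)
    (hanti : AntitoneOn h (Ioi 0)) :
    ∃ L ≤ ∫⁻ x in S, h ‖x‖ ∂μ, ∀ g : ℝ, 0 < g →
      (∫⁻ x in √g • S, h ‖x‖ ∂μ) + L ≤ (∫⁻ x in S, h ‖x‖ ∂μ) + ENNReal.ofReal g * L := by
  set d := Module.finrank ℝ E with hd
  set w : ℝ → ℝ≥0∞ := fun r ↦ ENNReal.ofReal ((r ^ (2 - d))⁻¹) * h r with hw_def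
  have hw : Measurable w := by fun_prop
  have hwanti : AntitoneOn w (Ioi 0) := by
    intro r hr s hs hrs
    have hr0 : 0 < r := hr
    simp only [hw_def]
    gcongr
    exact hanti hr hs hrs
  have hd1 : 1 ≤ d := Module.finrank_pos
  have hwr (r : ℝ) (hr : 0 < r) :
      ENNReal.ofReal (r ^ (d - 1)) * h r = ENNReal.ofReal r * w r := by
    rw [hw_def, ← mul_assoc, ← ENNReal.ofReal_mul hr.le]
    congr 2
    interval_cases d
    · simp [hr.ne']
    · simp
  let A (u : Metric.sphere (0 : E) 1) : Set ℝ := (fun r : ℝ ↦ r • (u : E)) ⁻¹' S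
  have hA (u) : MeasurableSet (A u) :=
    (by fun_prop : Measurable fun r : ℝ ↦ r • (u : E)) hS
  have hAstar (u) : ∀ r ∈ A u, 0 < r → ∀ s, 0 < s → s ≤ r → s ∈ A u := by
    intro r hr hr0 s hs hsr
    have := hstar.smul_mem (t := s / r) hr (by positivity) ((div_le_one hr0).2 hsr)
    rwa [smul_smul, div_mul_cancel₀ s hr0.ne'] at this
  have hpolar (T : Set E) (hT : MeasurableSet T) : ∫⁻ x in T, h ‖x‖ ∂μ =
      ∫⁻ u, (∫⁻ r in Ioi (0 : ℝ) ∩ (fun r : ℝ ↦ r • (u : E)) ⁻¹' T,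
        ENNReal.ofReal r * w r) ∂μ.toSphere := by
    rw [← lintegral_indicator hT,
      lintegral_eq_lintegral_toSphere μ
        ((by fun_prop : Measurable fun x : E ↦ h ‖x‖).indicator hT)]
    refine lintegral_congr fun u ↦ ?_
    have hB : MeasurableSet ((fun r : ℝ ↦ r • (u : E)) ⁻¹' T) :=
      (by fun_prop : Measurable fun r : ℝ ↦ r • (u : E)) hT
    rw [inter_comm, ← Measure.restrict_restrict hB, ← lintegral_indicator hB]
    refine setLIntegral_congr_fun measurableSet_Ioi fun r hr ↦ ?_
    by_cases hrT : r • (u : E) ∈ T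
    · have hr' : r ∈ (fun r : ℝ ↦ r • (u : E)) ⁻¹' T := hrT
      have hn : ‖r • (u : E)‖ = r := by simp [norm_smul, abs_of_pos (mem_Ioi.1 hr)]
      simp only [indicator_of_mem hrT, indicator_of_mem hr', hn]
      exact hwr r hr
    · have hr' : r ∉ (fun r : ℝ ↦ r • (u : E)) ⁻¹' T := hrT
      simp only [indicator_of_notMem hrT, indicator_of_notMem hr', mul_zero]
  choose l hl hlg using fun u ↦ setLIntegral_ray_le (hA u) (hAstar u) hw hwanti
  refine ⟨∫⁻ u, l u ∂μ.toSphere, ?_, fun g hg ↦ ?_⟩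
  · rw [hpolar S hS]
    exact lintegral_mono hl
  · have hg0 : √g ≠ 0 := (Real.sqrt_pos.2 hg).ne'
    have hmeas : Measurable fun u : Metric.sphere (0 : E) 1 ↦
        ∫⁻ r in Ioi (0 : ℝ) ∩ A u, ENNReal.ofReal r * w r := by
      have hQ : MeasurableSet {p : Metric.sphere (0 : E) 1 × ℝ |
          p.2 ∈ Ioi (0 : ℝ) ∧ p.2 • (p.1 : E) ∈ S} :=
        (measurable_snd measurableSet_Ioi).inter
          ((by fun_prop : Measurable fun p : Metric.sphere (0 : E) 1 × ℝ ↦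
            p.2 • (p.1 : E)) hS)
      have hG : Measurable fun p : Metric.sphere (0 : E) 1 × ℝ ↦ ENNReal.ofReal p.2 * w p.2 := by
        fun_prop
      have := (hG.indicator hQ).lintegral_prod_right' (ν := volume)
      convert this using 2 with u
      rw [← lintegral_indicator (measurableSet_Ioi.inter (hA u))]
      rfl
    rw [hpolar S hS, hpolar _ (hS.const_smul₀ _)]
    have hray (u : Metric.sphere (0 : E) 1) :
        (fun r : ℝ ↦ r • (u : E)) ⁻¹' (√g • S) = (fun r ↦ (√g)⁻¹ * r) ⁻¹' A u := by
      ext r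
      simp only [A, mem_preimage, mem_smul_set_iff_inv_smul_mem₀ hg0, smul_smul]
    simp only [hray]
    refine (le_lintegral_add _ _).trans ((lintegral_mono fun u ↦ hlg u g hg).trans ?_)
    rw [lintegral_add_left hmeas, lintegral_const_mul' _ _ ENNReal.ofReal_ne_top]

/-- The spherically-invariant density with mixing measure `μ`, as a function of the radius. -/
noncomputable def sirpProfile (n : ℕ) (μ : Measure ℝ) (r : ℝ) : ℝ≥0∞ :=
  ∫⁻ σ, ENNReal.ofReal ((2 * π * σ ^ 2) ^ (-(n : ℝ) / 2) *
    Real.exp (-r ^ 2 / (2 * σ ^ 2))) ∂μ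

theorem measurable_sirpProfile (n : ℕ) (μ : Measure ℝ) [SFinite μ] :
    Measurable (sirpProfile n μ) := by
  unfold sirpProfile
  fun_prop

theorem antitoneOn_sirpProfile (n : ℕ) (μ : Measure ℝ) :
    AntitoneOn (sirpProfile n μ) (Ioi 0) := by
  intro r hr s hs hrs
  have hr0 : 0 < r := hr
  unfold sirpProfile
  gcongr

theorem lintegral_sirpProfile (n : ℕ) (μ : Measure ℝ) [IsProbabilityMeasure μ]
    (hμ : ∀ᵐ σ ∂μ, 0 < σ) :
    ∫⁻ x : EuclideanSpace ℝ (Fin n), sirpProfile n μ ‖x‖ = 1 := by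
  unfold sirpProfile
  rw [lintegral_lintegral_swap (by fun_prop)]
  suffices H : ∀ᵐ σ ∂μ, ∫⁻ x : EuclideanSpace ℝ (Fin n),
      ENNReal.ofReal ((2 * π * σ ^ 2) ^ (-(n : ℝ) / 2) *
        Real.exp (-‖x‖ ^ 2 / (2 * σ ^ 2))) = 1 by
    rw [lintegral_congr_ae H]
    simp
  filter_upwards [hμ] with σ hσ
  have hb : 0 < (2 * σ ^ 2)⁻¹ := by positivity
  have hint := GaussianFourier.integral_rexp_neg_mul_sq_norm (V := EuclideanSpace ℝ (Fin n)) hb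
  have hexp : (fun x : EuclideanSpace ℝ (Fin n) ↦ Real.exp (-(2 * σ ^ 2)⁻¹ * ‖x‖ ^ 2)) =
      fun x ↦ Real.exp (-‖x‖ ^ 2 / (2 * σ ^ 2)) := by
    ext x
    congr 1
    ring
  have hbase : π / (2 * σ ^ 2)⁻¹ = 2 * π * σ ^ 2 := by
    field_simp
  rw [hexp, finrank_euclideanSpace_fin, hbase] at hint
  have hpos : 0 < (2 * π * σ ^ 2) ^ ((n : ℝ) / 2) := by positivity
  rw [← ofReal_integral_eq_lintegral_ofReal, integral_const_mul, hint, ← Real.rpow_add (by positivity)]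
  · simp [neg_div]
  · refine Integrable.const_mul (.of_integral_ne_zero ?_) _
    rw [hint]
    exact hpos.ne'
  · exact .of_forall fun x ↦ by positivity

/-- Fading is never good in low dimensions under
spherically-invariant noise: for `n ∈ {1, 2}` and SIRP noise, the average SER
over any normalized fading power-gain distribution is at least the non-fading
SER at the same average SNR. -/
theorem fading_never_good_low_dim_sirp
    (n M : ℕ) (hn : n = 1 ∨ n = 2)
    (μ : Measure ℝ) [IsProbabilityMeasure μ]
    (hμsupp : μ (Ioi (0 : ℝ))ᶜ = 0)
    (f : EuclideanSpace ℝ (Fin n) → ℝ)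
    (hf : ∀ x, f x = ∫ σ,
      (2 * π * σ ^ 2) ^ (-(n : ℝ) / 2) * Real.exp (-‖x‖ ^ 2 / (2 * σ ^ 2)) ∂μ)
    (q : Fin M → ℝ) (hq : ∀ i, 0 ≤ q i) (hqsum : ∑ i, q i = 1)
    (Ω : Fin M → Set (EuclideanSpace ℝ (Fin n)))
    (hΩmeas : ∀ i, MeasurableSet (Ω i))
    (hΩstar : ∀ i, StarConvex ℝ (0 : EuclideanSpace ℝ (Fin n)) (Ω i))
    (Pe : ℝ → ℝ)
    (hPe : ∀ γ, Pe γ = 1 - ∑ i, q i * ∫ x in Real.sqrt γ • Ω i, f x)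
    (ν : Measure ℝ) [IsProbabilityMeasure ν]
    (hνsupp : ν (Ioi (0 : ℝ))ᶜ = 0)
    (hνmean : ∫ g, g ∂ν = 1)
    (γ₀ : ℝ) (hγ₀ : 0 < γ₀) :
    Pe γ₀ ≤ ∫ g, Pe (g * γ₀) ∂ν := by
  have hn0 : n ≠ 0 := by rcases hn with rfl | rfl <;> norm_num
  have : NeZero n := ⟨hn0⟩
  have hμpos : ∀ᵐ σ ∂μ, 0 < σ := hμsupp
  have hνpos : ∀ᵐ g ∂ν, 0 < g := hνsupp
  have hmeas : Measurable fun x : EuclideanSpace ℝ (Fin n) ↦ sirpProfile n μ ‖x‖ :=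
    (measurable_sirpProfile n μ).comp measurable_norm
  have htotal := lintegral_sirpProfile n μ hμpos
  have hle (T : Set (EuclideanSpace ℝ (Fin n))) : ∫⁻ x in T, sirpProfile n μ ‖x‖ ≤ 1 :=
    (setLIntegral_le_lintegral _ _).trans htotal.le
  have hne (T : Set (EuclideanSpace ℝ (Fin n))) : ∫⁻ x in T, sirpProfile n μ ‖x‖ ≠ ∞ :=
    ((hle T).trans_lt ENNReal.one_lt_top).ne
  have hfT (T : Set (EuclideanSpace ℝ (Fin n))) :
      ∫ x in T, f x = (∫⁻ x in T, sirpProfile n μ ‖x‖).toReal := by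
    rw [← integral_toReal hmeas.aemeasurable (ae_lt_top hmeas (hne T))]
    congr 1 with x
    rw [hf, sirpProfile, integral_eq_lintegral_of_nonneg_ae]
    · exact .of_forall fun σ ↦ by positivity
    · exact Measurable.aestronglyMeasurable (by fun_prop)
  have hmono (i : Fin M) : Monotone fun γ ↦ ∫ x in √γ • Ω i, f x := by
    intro a b hab
    simp only [hfT]
    refine ENNReal.toReal_mono (hne _) (lintegral_mono_set ?_)
    exact (hΩstar i).smul_set_subset_smul_set (Real.sqrt_nonneg a) (Real.sqrt_le_sqrt hab)
  have hint (i : Fin M) : Integrable (fun g ↦ ∫ x in √(g * γ₀) • Ω i, f x) ν := by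
    refine .of_bound (C := 1) ?_ (.of_forall fun g ↦ ?_)
    · exact ((hmono i).measurable.comp (measurable_mul_const γ₀)).aestronglyMeasurable
    · rw [hfT, Real.norm_of_nonneg ENNReal.toReal_nonneg]
      exact ENNReal.toReal_le_of_le_ofReal zero_le_one (by simpa using hle _)
  have hsupport (i : Fin M) : ∃ L : ℝ, ∀ g : ℝ, 0 < g →
      ∫ x in √(g * γ₀) • Ω i, f x ≤ (∫ x in √γ₀ • Ω i, f x) + L * (g - 1) := by
    have hstar : StarConvex ℝ 0 (√γ₀ • Ω i) := by simpa using (hΩstar i).smul √γ₀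
    obtain ⟨L, hL, hLg⟩ := hstar.setLIntegral_sqrt_smul_le volume
      (by rw [finrank_euclideanSpace_fin]; lia) ((hΩmeas i).const_smul₀ _)
      (measurable_sirpProfile n μ) (antitoneOn_sirpProfile n μ)
    have hL_top : L ≠ ∞ := (hL.trans_lt (hne _).lt_top).ne
    refine ⟨L.toReal, fun g hg ↦ ?_⟩
    have hg_ne : ENNReal.ofReal g * L ≠ ∞ := ENNReal.mul_ne_top ENNReal.ofReal_ne_top hL_top
    have key := ENNReal.toReal_mono (ENNReal.add_ne_top.2 ⟨hne _, hg_ne⟩) (hLg g hg)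
    rw [ENNReal.toReal_add (hne _) hL_top, ENNReal.toReal_add (hne _) hg_ne, ENNReal.toReal_mul,
      ENNReal.toReal_ofReal hg.le, smul_smul, ← Real.sqrt_mul hg.le] at key
    rw [hfT, hfT]
    linarith
  choose L hL using hsupport
  have hid : Integrable (fun g : ℝ ↦ g) ν := .of_integral_ne_zero (by simp [hνmean])
  have hslope : Integrable (fun g ↦ (∑ i, q i * L i) * (g - 1)) ν :=
    (hid.sub (integrable_const 1)).const_mul _
  have hline : Integrable (fun g ↦ Pe γ₀ - (∑ i, q i * L i) * (g - 1)) ν :=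
    (integrable_const _).sub hslope
  have hPeint : Integrable (fun g ↦ Pe (g * γ₀)) ν := by
    simp only [hPe]
    exact (integrable_const _).sub (integrable_finsetSum _ fun i _ ↦ (hint i).const_mul _)
  calc Pe γ₀ = ∫ g, (Pe γ₀ - (∑ i, q i * L i) * (g - 1)) ∂ν := by
        rw [integral_sub (integrable_const _) hslope, integral_const_mul,
          integral_sub hid (integrable_const 1), hνmean]
        simp
    _ ≤ ∫ g, Pe (g * γ₀) ∂ν := by
        refine integral_mono_ae hline hPeint ?_
        filter_upwards [hνpos] with g hg
        have hsum : ∑ i, q i * ∫ x in √(g * γ₀) • Ω i, f x ≤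
            ∑ i, q i * ((∫ x in √γ₀ • Ω i, f x) + L i * (g - 1)) :=
          Finset.sum_le_sum fun i _ ↦ mul_le_mul_of_nonneg_left (hL i g hg) (hq i)
        simp only [mul_add, Finset.sum_add_distrib, ← mul_assoc, ← Finset.sum_mul] at hsum
        rw [hPe, hPe]
        linarith
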